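/- Let q ≥ 1 be an integer, let (s_j)_{j=0}^∞ be a Stieltjes positive definite sequence of complex q×q matrices with associated matrix polynomials P_n, Q_n, P̂_n, Q̂_n, and let P_n^{(1)}, Q_n^{(1)}, P̂_n^{(1)}, Q̂_n^{(1)} be the corresponding polynomials built from the first Kátětov transform (s_j^{(1)})_{j=0}^∞. Let n ∈ ℕ and let z ∈ ℂ∖[0,∞); then the matrices Q_n(z), Q̂_n(z), P_n^{(1)}(z), and P̂_{n−1}^{(1)}(z) are invertible, and the following two identities hold: s_0 · P_n(z) [Q_n(z)]^{−1} · s_0 + Q̂_{n−1}^{(1)}(z) [P̂_{n−1}^{(1)}(z)]^{−1} = z·s_0, and s_0 · P̂_n(z) [Q̂_n(z)]^{−1} · s_0 + Q_n^{(1)}(z) [P_n^{(1)}(z)]^{−1} = s_0. -/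

import Mathlib

open Matrix
open scoped ComplexOrder

noncomputable section

/-- The space of complex `q × q` matrices. -/
abbrev Mq (q : ℕ) := Matrix (Fin q) (Fin q) ℂ

/-- The space of complex `2q × 2q` matrices, written in `q × q` blocks. -/
abbrev M2q (q : ℕ) := Matrix (Fin q ⊕ Fin q) (Fin q ⊕ Fin q) ℂ

/-- Block Hankel matrix `H_n = (s_{j+k})_{j,k=0}^n`. -/
def Hmat (q : ℕ) (s : ℕ → Mq q) (n : ℕ) :
    Matrix (Fin (n + 1) × Fin q) (Fin (n + 1) × Fin q) ℂ :=
  Matrix.of fun p r => s (p.1.1 + r.1.1) p.2 r.2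

/-- Block Hankel matrix `K_n = (s_{j+k+1})_{j,k=0}^n`. -/
def Kmat (q : ℕ) (s : ℕ → Mq q) (n : ℕ) :
    Matrix (Fin (n + 1) × Fin q) (Fin (n + 1) × Fin q) ℂ :=
  Matrix.of fun p r => s (p.1.1 + r.1.1 + 1) p.2 r.2

/-- A sequence of complex `q × q` matrices is Stieltjes positive definite if all the
block Hankel matrices `H_n` and `K_n` are positive definite (in particular Hermitian). -/
def IsStieltjesPD (q : ℕ) (s : ℕ → Mq q) : Prop :=
  ∀ n : ℕ, (Hmat q s n).PosDef ∧ (Kmat q s n).PosDef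

/-- Even Stieltjes parameters `𝔮_{2k}` (Schur complements `L_k`). -/
def qEven (q : ℕ) (s : ℕ → Mq q) : ℕ → Mq q
  | 0 => s 0
  | k + 1 =>
      s (2 * (k + 1)) -
        (Matrix.of fun (a : Fin q) (r : Fin (k + 1) × Fin q) => s (k + 1 + r.1.1) a r.2) *
          (Hmat q s k)⁻¹ *
          (Matrix.of fun (p : Fin (k + 1) × Fin q) (b : Fin q) => s (k + 1 + p.1.1) p.2 b)

/-- Odd Stieltjes parameters `𝔮_{2k+1}` (Schur complements `Λ_k`). -/
def qOdd (q : ℕ) (s : ℕ → Mq q) : ℕ → Mq q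
  | 0 => s 1
  | k + 1 =>
      s (2 * (k + 1) + 1) -
        (Matrix.of fun (a : Fin q) (r : Fin (k + 1) × Fin q) => s (k + 2 + r.1.1) a r.2) *
          (Kmat q s k)⁻¹ *
          (Matrix.of fun (p : Fin (k + 1) × Fin q) (b : Fin q) => s (k + 2 + p.1.1) p.2 b)

/-- Stieltjes parametrization `𝔮_j`. -/
def qpar (q : ℕ) (s : ℕ → Mq q) (j : ℕ) : Mq q :=
  if j % 2 = 0 then qEven q s (j / 2) else qOdd q s (j / 2)

/-- Reciprocal sequence `s^♯`. -/
def reciprocal (q : ℕ) (s : ℕ → Mq q) : ℕ → Mq q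
  | 0 => (s 0)⁻¹
  | j + 1 =>
      -(s 0)⁻¹ *
        ∑ l ∈ (Finset.range (j + 1)).attach, s (j + 1 - l.1) * reciprocal q s l.1
  decreasing_by exact Finset.mem_range.mp l.2

/-- First Kátětov transform `s^{(1)}_j = −s_0 s_{j+1}^♯ s_0`. -/
def katetov1 (q : ℕ) (s : ℕ → Mq q) : ℕ → Mq q :=
  fun j => -(s 0) * reciprocal q s (j + 1) * s 0

/-- `ℓ`-th Kátětov transform (the `ℓ`-fold iterate of the first Kátětov transform). -/
def katetov (q : ℕ) (ℓ : ℕ) (s : ℕ → Mq q) : ℕ → Mq q :=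
  (katetov1 q)^[ℓ] s

/-- `v_k = col(I_q, 0_{kq×q})`. -/
def vcol (q k : ℕ) : Matrix (Fin (k + 1) × Fin q) (Fin q) ℂ :=
  Matrix.of fun p b => if p.1.1 = 0 ∧ p.2 = b then 1 else 0

/-- `y_{0,k} = col(s_0, …, s_k)`. -/
def ycol (q : ℕ) (s : ℕ → Mq q) (k : ℕ) : Matrix (Fin (k + 1) × Fin q) (Fin q) ℂ :=
  Matrix.of fun p b => s p.1.1 p.2 b

/-- Dyukarev–Stieltjes parameters `𝔐_k`. -/
def DSM (q : ℕ) (s : ℕ → Mq q) : ℕ → Mq q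
  | 0 => (s 0)⁻¹
  | k + 1 =>
      (vcol q (k + 1))ᴴ * (Hmat q s (k + 1))⁻¹ * vcol q (k + 1) -
        (vcol q k)ᴴ * (Hmat q s k)⁻¹ * vcol q k

/-- Dyukarev–Stieltjes parameters `𝔏_k`. -/
def DSL (q : ℕ) (s : ℕ → Mq q) : ℕ → Mq q
  | 0 => s 0 * (s 1)⁻¹ * s 0
  | k + 1 =>
      (ycol q s (k + 1))ᴴ * (Kmat q s (k + 1))⁻¹ * ycol q s (k + 1) -
        (ycol q s k)ᴴ * (Kmat q s k)⁻¹ * ycol q s k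

/-- Ordered product `A_0 A_1 ⋯ A_n`. -/
def oprod {α : Type*} [Monoid α] (f : ℕ → α) (n : ℕ) : α :=
  ((List.range (n + 1)).map f).prod

/-- Block shift `T_n = (δ_{j,k+1} I_q)_{j,k=0}^n`. -/
def Tmat (q n : ℕ) : Matrix (Fin (n + 1) × Fin q) (Fin (n + 1) × Fin q) ℂ :=
  Matrix.of fun p r => if p.1.1 = r.1.1 + 1 ∧ p.2 = r.2 then 1 else 0

/-- `R_n(z) = (I_{(n+1)q} − z T_n)⁻¹`. -/
def Rmat (q n : ℕ) (z : ℂ) : Matrix (Fin (n + 1) × Fin q) (Fin (n + 1) × Fin q) ℂ :=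
  (1 - z • Tmat q n)⁻¹

/-- `u_0 = 0`, `u_n = col(0_{q×q}, −y_{0,n−1})`. -/
def ucol (q : ℕ) (s : ℕ → Mq q) (n : ℕ) : Matrix (Fin (n + 1) × Fin q) (Fin q) ℂ :=
  Matrix.of fun p b => if p.1.1 = 0 then 0 else -(s (p.1.1 - 1) p.2 b)

/-- `col(−H_n⁻¹ y_{n+1,2n+1}, I_q)` of size `(n+2)q × q`. -/
def colH (q : ℕ) (s : ℕ → Mq q) (n : ℕ) : Matrix (Fin (n + 2) × Fin q) (Fin q) ℂ :=
  Matrix.of fun p b =>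
    if h : p.1.1 < n + 1 then
      (-((Hmat q s n)⁻¹ *
          Matrix.of fun (r : Fin (n + 1) × Fin q) (c : Fin q) => s (n + 1 + r.1.1) r.2 c))
        (⟨p.1.1, h⟩, p.2) b
    else if p.2 = b then 1 else 0

/-- `col(−K_n⁻¹ y_{n+2,2n+2}, I_q)` of size `(n+2)q × q`. -/
def colK (q : ℕ) (s : ℕ → Mq q) (n : ℕ) : Matrix (Fin (n + 2) × Fin q) (Fin q) ℂ :=
  Matrix.of fun p b =>
    if h : p.1.1 < n + 1 then
      (-((Kmat q s n)⁻¹ *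
          Matrix.of fun (r : Fin (n + 1) × Fin q) (c : Fin q) => s (n + 2 + r.1.1) r.2 c))
        (⟨p.1.1, h⟩, p.2) b
    else if p.2 = b then 1 else 0

/-- `z_{0,n} = row(s_0, …, s_n)`. -/
def zrow (q : ℕ) (s : ℕ → Mq q) (n : ℕ) : Matrix (Fin q) (Fin (n + 1) × Fin q) ℂ :=
  Matrix.of fun a r => s r.1.1 a r.2

/-- Orthogonal matrix polynomials `P_n`. -/
def Ppoly (q : ℕ) (s : ℕ → Mq q) : ℕ → ℂ → Mq q
  | 0, _ => 1
  | n + 1, z => (vcol q (n + 1))ᴴ * (Rmat q (n + 1) (starRingEnd ℂ z))ᴴ * colH q s n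

/-- Second kind matrix polynomials `Q_n`. -/
def Qpoly (q : ℕ) (s : ℕ → Mq q) : ℕ → ℂ → Mq q
  | 0, _ => 0
  | n + 1, z => -((ucol q s (n + 1))ᴴ * (Rmat q (n + 1) (starRingEnd ℂ z))ᴴ * colH q s n)

/-- Matrix polynomials `P̂_n`. -/
def Phat (q : ℕ) (s : ℕ → Mq q) : ℕ → ℂ → Mq q
  | 0, _ => 1
  | n + 1, z => (vcol q (n + 1))ᴴ * (Rmat q (n + 1) (starRingEnd ℂ z))ᴴ * colK q s n

/-- Matrix polynomials `Q̂_n`. -/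
def Qhat (q : ℕ) (s : ℕ → Mq q) : ℕ → ℂ → Mq q
  | 0, _ => s 0
  | n + 1, z => zrow q s (n + 1) * (Rmat q (n + 1) (starRingEnd ℂ z))ᴴ * colK q s n

/-- `α_n(z)`. -/
def alphaP (q : ℕ) (s : ℕ → Mq q) (n : ℕ) (z : ℂ) : Mq q :=
  1 - z • ((ucol q s n)ᴴ * (Rmat q n (starRingEnd ℂ z))ᴴ * (Hmat q s n)⁻¹ * vcol q n)

/-- `γ_n(z)`. -/
def gammaP (q : ℕ) (s : ℕ → Mq q) (n : ℕ) (z : ℂ) : Mq q :=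
  -(z • ((vcol q n)ᴴ * (Rmat q n (starRingEnd ℂ z))ᴴ * (Hmat q s n)⁻¹ * vcol q n))

/-- `β_n(z)`. -/
def betaP (q : ℕ) (s : ℕ → Mq q) : ℕ → ℂ → Mq q
  | 0, _ => 0
  | n + 1, z => (ycol q s n)ᴴ * (Rmat q n (starRingEnd ℂ z))ᴴ * (Kmat q s n)⁻¹ * ycol q s n

/-- `δ_n(z)`. -/
def deltaP (q : ℕ) (s : ℕ → Mq q) : ℕ → ℂ → Mq q
  | 0, _ => 1
  | n + 1, z =>
      1 + z • ((vcol q n)ᴴ * (Rmat q n (starRingEnd ℂ z))ᴴ * (Kmat q s n)⁻¹ * ycol q s n)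

/-- The resolvent matrices `U_m(z)`. -/
def Umat (q : ℕ) (s : ℕ → Mq q) (m : ℕ) (z : ℂ) : M2q q :=
  if m % 2 = 0 then
    Matrix.fromBlocks (alphaP q s (m / 2) z) (betaP q s (m / 2) z)
      (gammaP q s (m / 2) z) (deltaP q s (m / 2) z)
  else
    Matrix.fromBlocks (alphaP q s (m / 2) z) (betaP q s (m / 2 + 1) z)
      (gammaP q s (m / 2) z) (deltaP q s (m / 2 + 1) z)

/-- `𝕄_k(z) = [[I, 0], [−z𝔐_k, I]]`. -/
def MM (q : ℕ) (s : ℕ → Mq q) (k : ℕ) (z : ℂ) : M2q q :=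
  Matrix.fromBlocks 1 0 (-(z • DSM q s k)) 1

/-- `𝕃_k = [[I, 𝔏_k], [0, I]]`. -/
def LL (q : ℕ) (s : ℕ → Mq q) (k : ℕ) : M2q q :=
  Matrix.fromBlocks 1 (DSL q s k) 0 1

/-- `𝒫_n = diag([P_n(0)]^{−*}, P_n(0))`. -/
def PPmat (q : ℕ) (s : ℕ → Mq q) (n : ℕ) : M2q q :=
  Matrix.fromBlocks (((Ppoly q s n 0)⁻¹)ᴴ) 0 0 (Ppoly q s n 0)

/-- `𝐐_n(z) = [[0, Q̂_n(0)], [−z[Q̂_n(0)]^{−*}, 0]]`. -/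
def QQgen (q : ℕ) (s : ℕ → Mq q) (n : ℕ) (z : ℂ) : M2q q :=
  Matrix.fromBlocks 0 (Qhat q s n 0) (-(z • ((Qhat q s n 0)⁻¹)ᴴ)) 0

/-- `𝐐_0^{(ℓ)}(z) = [[0, s_0^{(ℓ)}], [−z(s_0^{(ℓ)})⁻¹, 0]]`. -/
def QQ0 (q : ℕ) (s : ℕ → Mq q) (ℓ : ℕ) (z : ℂ) : M2q q :=
  Matrix.fromBlocks 0 (katetov q ℓ s 0) (-(z • (katetov q ℓ s 0)⁻¹)) 0

/-- `𝒬_m(z) = 𝐐_0^{(0)}(z) ⋯ 𝐐_0^{(m)}(z)`. -/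
def Qprod (q : ℕ) (s : ℕ → Mq q) (m : ℕ) (z : ℂ) : M2q q :=
  oprod (fun ℓ => QQ0 q s ℓ z) m

namespace Pade

open PowerSeries

/-- Generating series of a sequence. -/
def gs {q : ℕ} (s : ℕ → Mq q) : PowerSeries (Mq q) := PowerSeries.mk s

/-- Reversed evaluation of the truncation of a power series. -/
def ev {q : ℕ} (n : ℕ) (f : PowerSeries (Mq q)) (z : ℂ) : Mq q :=
  ∑ m ∈ Finset.range (n + 1), z ^ (n - m) • coeff m f

/-- The shifted sequence. -/
def sh {q : ℕ} (s : ℕ → Mq q) : ℕ → Mq q := fun j => s (j + 1)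

/-- Coefficientwise conjugate transpose. -/
def st {q : ℕ} (f : PowerSeries (Mq q)) : PowerSeries (Mq q) :=
  PowerSeries.mk fun n => (coeff n f)ᴴ

/-- The Hankel form (with offset `d`). -/
def form {q : ℕ} (s : ℕ → Mq q) (m d : ℕ) (g : PowerSeries (Mq q)) : Mq q :=
  ∑ j ∈ Finset.range (m + 1), (coeff (m - j) g)ᴴ * coeff (m + d + j) (gs s * g)

/-- Reversed orthogonal polynomials. -/
structure IsOP {q : ℕ} (s : ℕ → Mq q) (n : ℕ) (p : PowerSeries (Mq q)) : Prop where
  c0 : coeff 0 p = 1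
  deg : ∀ m, n < m → coeff m p = 0
  orth : ∀ j, j < n → coeff (n + j) (gs s * p) = 0

variable {q : ℕ}

theorem ev_zero (f : PowerSeries (Mq q)) (z : ℂ) : ev 0 f z = coeff 0 f := by
  simp [ev]

theorem ev_succ (n : ℕ) (f : PowerSeries (Mq q)) (z : ℂ) :
    ev (n + 1) f z = z • ev n f z + coeff (n + 1) f := by
  unfold ev
  rw [Finset.sum_range_succ, Finset.smul_sum]
  simp only [Nat.sub_self, pow_zero, one_smul]
  congr 1
  apply Finset.sum_congr rfl
  intro m hm
  rw [Finset.mem_range] at hm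
  rw [smul_smul, ← pow_succ', show n + 1 - m = n - m + 1 by omega]

theorem ev_add (n : ℕ) (f g : PowerSeries (Mq q)) (z : ℂ) :
    ev n (f + g) z = ev n f z + ev n g z := by
  simp [ev, Finset.sum_add_distrib]

theorem ev_sub (n : ℕ) (f g : PowerSeries (Mq q)) (z : ℂ) :
    ev n (f - g) z = ev n f z - ev n g z := by
  simp [ev, Finset.sum_sub_distrib, smul_sub]

theorem ev_C_mul (n : ℕ) (a : Mq q) (f : PowerSeries (Mq q)) (z : ℂ) :
    ev n (C a * f) z = a * ev n f z := by
  simp [ev, Finset.mul_sum, coeff_C_mul]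

theorem ev_X_mul (n : ℕ) (f : PowerSeries (Mq q)) (z : ℂ) :
    ev (n + 1) (X * f) z = ev n f z := by
  induction n with
  | zero => rw [ev_succ, ev_zero, ev_zero, coeff_succ_X_mul]; simp
  | succ n ih => rw [ev_succ, ih, ev_succ, coeff_succ_X_mul]

theorem ev_congr (n : ℕ) (f g : PowerSeries (Mq q)) (z : ℂ)
    (h : ∀ m, m ≤ n → coeff m f = coeff m g) : ev n f z = ev n g z := by
  unfold ev
  apply Finset.sum_congr rfl
  intro m hm
  rw [h m (by rw [Finset.mem_range] at hm; omega)]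

theorem coeff_hankel (s : ℕ → Mq q) (m j : ℕ) (g : PowerSeries (Mq q))
    (hg : ∀ k, m < k → coeff k g = 0) :
    coeff (m + j) (gs s * g) =
      ∑ k ∈ Finset.range (m + 1), s (j + k) * coeff (m - k) g := by
  rw [coeff_mul, ← Finset.Nat.sum_antidiagonal_swap,
    Finset.Nat.sum_antidiagonal_eq_sum_range_succ_mk,
    ← Finset.sum_range_reflect (fun k => s (j + k) * coeff (m - k) g)]
  symm
  have hsub : Finset.range (m + 1) ⊆ Finset.range (m + j).succ := by
    intro x hx
    rw [Finset.mem_range] at *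
    omega
  rw [← Finset.sum_subset hsub]
  · apply Finset.sum_congr rfl
    intro k hk
    rw [Finset.mem_range] at hk
    simp only [gs, Prod.swap, coeff_mk]
    rw [show j + (m + 1 - 1 - k) = m + j - k by omega, show m - (m + 1 - 1 - k) = k by omega]
  · intro k _ hk
    rw [Finset.mem_range] at hk
    simp only [Prod.swap]
    rw [hg k (by omega), mul_zero]

theorem gs_eq_sh (s : ℕ → Mq q) : gs s = C (s 0) + X * gs (sh s) := by
  ext n : 1
  cases n with
  | zero => simp [gs]
  | succ n => rw [map_add, coeff_succ_X_mul]; simp [gs, sh]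

theorem coeff_sh (s : ℕ → Mq q) (m : ℕ) (g : PowerSeries (Mq q)) (h : coeff (m + 1) g = 0) :
    coeff (m + 1) (gs s * g) = coeff m (gs (sh s) * g) := by
  rw [gs_eq_sh s, add_mul, mul_assoc, map_add, coeff_succ_X_mul, coeff_C_mul, h, mul_zero, zero_add]

theorem form_sh (s : ℕ → Mq q) (m d : ℕ) (g : PowerSeries (Mq q))
    (hg : ∀ k, m < k → coeff k g = 0) : form (sh s) m d g = form s m (d + 1) g := by
  unfold form
  apply Finset.sum_congr rfl
  intro j _
  rw [show m + (d + 1) + j = m + d + j + 1 by omega, coeff_sh _ _ _ (hg _ (by omega))]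

theorem form_apply (s : ℕ → Mq q) (m : ℕ) (g : PowerSeries (Mq q))
    (hg : ∀ k, m < k → coeff k g = 0) (i : Fin q) :
    (star fun p : Fin (m + 1) × Fin q => coeff (m - p.1.1) g p.2 i) ⬝ᵥ
      (Hmat q s m *ᵥ fun p : Fin (m + 1) × Fin q => coeff (m - p.1.1) g p.2 i) =
    form s m 0 g i i := by
  unfold form
  have h : ∀ j, coeff (m + 0 + j) (gs s * g) =
      ∑ k ∈ Finset.range (m + 1), s (j + k) * coeff (m - k) g := by
    intro j; rw [add_zero]; exact coeff_hankel s m j g hg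
  simp only [h]
  simp only [Finset.sum_range, Matrix.sum_apply, Matrix.mul_apply, dotProduct, mulVec, Hmat,
    Fintype.sum_prod_type, Pi.star_apply, Matrix.of_apply, Matrix.conjTranspose_apply]

theorem posDef_form {s : ℕ → Mq q} {m : ℕ} (h : (Hmat q s m).PosDef) (g : PowerSeries (Mq q))
    (hg : ∀ k, m < k → coeff k g = 0) (i : Fin q) (hne : ∃ k a, coeff k g a i ≠ 0) :
    0 < form s m 0 g i i := by
  rw [← form_apply s m g hg i]
  apply h.dotProduct_mulVec_pos
  intro h0
  obtain ⟨k, a, hk⟩ := hne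
  by_cases hkm : m < k
  · rw [hg k hkm] at hk; exact hk rfl
  · have := congrFun h0 (⟨m - k, by omega⟩, a)
    simp only [Pi.zero_apply] at this
    rw [show m - (m - k) = k by omega] at this
    exact hk this

theorem form_posDef {s : ℕ → Mq q} {m : ℕ} (hs : ∀ j, (s j)ᴴ = s j)
    (h : ∀ (g : PowerSeries (Mq q)) (i : Fin q), (∀ k, m < k → coeff k g = 0) →
      (∃ k a, coeff k g a i ≠ 0) → 0 < form s m 0 g i i) : (Hmat q s m).PosDef := by
  apply Matrix.PosDef.of_dotProduct_mulVec_pos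
  · ext p r
    have := congrFun (congrFun (hs (p.1.1 + r.1.1)) p.2) r.2
    simp only [Hmat, conjTranspose_apply, of_apply] at *
    rw [add_comm]; exact this
  · intro x hx
    obtain ⟨⟨k, a⟩, hk⟩ := Function.ne_iff.mp hx
    let g : PowerSeries (Mq q) := PowerSeries.mk fun j =>
      if h : m - j < m + 1 ∧ j ≤ m then Matrix.of fun c _ => x (⟨m - j, h.1⟩, c) else 0
    have hg : ∀ k, m < k → coeff k g = 0 := by
      intro k hk
      simp only [g, coeff_mk]
      rw [dif_neg (by omega)]
    have hgx : (fun p : Fin (m + 1) × Fin q => coeff (m - p.1.1) g p.2 a) = x := by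
      funext p
      have := p.1.2
      simp only [g, coeff_mk]
      rw [dif_pos (by omega)]
      simp only [of_apply]
      congr 2
      ext
      simp only []
      omega
    have := h g a hg ⟨m - k.1, a, by
      have := congrFun hgx (k, a)
      simp only [] at this
      rw [this]; exact hk⟩
    rw [← form_apply s m g hg a, hgx] at this
    exact this

theorem Kmat_eq (s : ℕ → Mq q) (n : ℕ) : Kmat q s n = Hmat q (sh s) n := rfl

theorem sh_PD {s : ℕ → Mq q} (hs : IsStieltjesPD q s) : IsStieltjesPD q (sh s) := by
  intro n
  refine ⟨(hs n).2, ?_⟩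
  have := (hs (n + 1)).1.submatrix (e := fun p : Fin (n + 1) × Fin q => (p.1.succ, p.2)) (by
    intro p r h
    simp only [Prod.mk.injEq, Fin.succ_inj] at h
    exact Prod.ext h.1 h.2)
  convert this using 1
  ext p r
  simp only [Kmat, Hmat, sh, of_apply, submatrix_apply, Fin.val_succ]
  rw [show p.1.1 + r.1.1 + 1 + 1 = p.1.1 + 1 + (r.1.1 + 1) by omega]

theorem herm_of_PD {s : ℕ → Mq q} (hs : IsStieltjesPD q s) (j : ℕ) : (s j)ᴴ = s j := by
  have := (hs j).1.isHermitian
  ext a b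
  have h2 := congrFun (congrFun this (⟨j, by omega⟩, a)) (⟨0, by omega⟩, b)
  simpa [Hmat] using h2

theorem PD_form1 {s : ℕ → Mq q} (h : IsStieltjesPD q s) (m : ℕ) (g : PowerSeries (Mq q))
    (hg : ∀ k, m < k → coeff k g = 0) (i : Fin q) (hne : ∃ k a, coeff k g a i ≠ 0) :
    0 < form s m 1 g i i := by
  rw [← form_sh s m 0 g hg]
  exact posDef_form (sh_PD h m).1 g hg i hne

/-- Explicit form of the resolvent of the block shift. -/
theorem Rmat_apply (n : ℕ) (z : ℂ) :
    Rmat q n z = Matrix.of fun p r =>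
      if r.1.1 ≤ p.1.1 ∧ p.2 = r.2 then z ^ (p.1.1 - r.1.1) else 0 := by
  unfold Rmat
  apply Matrix.inv_eq_right_inv
  ext ⟨i, a⟩ ⟨j, b⟩
  rw [sub_mul, one_mul, Matrix.sub_apply, Matrix.smul_mul, Matrix.smul_apply]
  have key : (Tmat q n * Matrix.of fun p r : Fin (n + 1) × Fin q =>
      if r.1.1 ≤ p.1.1 ∧ p.2 = r.2 then z ^ (p.1.1 - r.1.1) else 0) (i, a) (j, b) =
      if j.1 < i.1 ∧ a = b then z ^ (i.1 - 1 - j.1) else 0 := by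
    rw [Matrix.mul_apply]
    by_cases hi : i.1 = 0
    · rw [if_neg (by omega)]
      apply Finset.sum_eq_zero
      intro p _
      simp only [Tmat, of_apply]
      rw [if_neg (by omega), zero_mul]
    · have hi2 := i.2
      rw [Finset.sum_eq_single ((⟨i.1 - 1, by omega⟩ : Fin (n + 1)), a)]
      · simp only [Tmat, of_apply]
        rw [if_pos (⟨(by show i.1 = i.1 - 1 + 1; omega), trivial⟩), one_mul]
        refine if_congr ?_ rfl rfl
        constructor
        · rintro ⟨h1, h2⟩; exact ⟨by omega, h2⟩
        · rintro ⟨h1, h2⟩; exact ⟨by omega, h2⟩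
      · rintro ⟨k, c⟩ _ hne
        simp only [Tmat, of_apply]
        rw [if_neg, zero_mul]
        rintro ⟨h1, h2⟩
        apply hne
        refine Prod.ext (Fin.ext ?_) h2.symm
        simp only []
        omega
      · intro h; exact absurd (Finset.mem_univ _) h
  rw [key]
  simp only [of_apply, smul_eq_mul]
  by_cases hab : a = b
  · subst hab
    rcases lt_trichotomy i.1 j.1 with h | h | h
    · rw [if_neg (by omega), if_neg (by omega), Matrix.one_apply_ne]
      · simp
      · intro h2; have := congrArg (fun p => p.1.1) h2; simp only [] at this; omega
    · have : i = j := Fin.ext h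
      subst this
      simp
    · rw [if_pos ⟨by omega, rfl⟩, if_pos ⟨by omega, rfl⟩, Matrix.one_apply_ne,
        ← pow_succ', show i.1 - 1 - j.1 + 1 = i.1 - j.1 by omega, sub_self]
      intro h2; have := congrArg (fun p => p.1.1) h2; simp only [] at this; omega
  · rw [if_neg (fun h => hab h.2), if_neg (fun h => hab h.2), Matrix.one_apply_ne]
    · simp
    · intro h2; exact hab (congrArg (fun p => p.2) h2)

/-- Reversed power series associated with a block column. -/
def rev (N : ℕ) (M : Matrix (Fin (N + 1) × Fin q) (Fin q) ℂ) : PowerSeries (Mq q) :=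
  PowerSeries.mk fun i =>
    if h : N - i < N + 1 ∧ i ≤ N then Matrix.of fun a b => M (⟨N - i, h.1⟩, a) b else 0

theorem rev_coeff (N : ℕ) (M : Matrix (Fin (N + 1) × Fin q) (Fin q) ℂ) (k : Fin (N + 1)) :
    coeff (N - k.1) (rev N M) = Matrix.of fun a b => M (k, a) b := by
  have := k.2
  unfold rev
  rw [coeff_mk, dif_pos (by omega)]
  ext a b
  simp only [of_apply]
  congr 2
  ext
  simp only []
  omega

theorem rev_deg (N : ℕ) (M : Matrix (Fin (N + 1) × Fin q) (Fin q) ℂ) (k : ℕ) (h : N < k) :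
    coeff k (rev N M) = 0 := by
  unfold rev
  rw [coeff_mk, dif_neg (by omega)]

theorem ev_gs_mul (N : ℕ) (c : ℕ → Mq q) (f : PowerSeries (Mq q)) (z : ℂ) :
    ev N (gs c * f) z = ∑ k ∈ Finset.range (N + 1), ∑ l ∈ Finset.range (k + 1),
      z ^ (k - l) • (c l * coeff (N - k) f) := by
  unfold ev
  simp only [coeff_mul, Finset.Nat.sum_antidiagonal_eq_sum_range_succ_mk, Finset.smul_sum, gs,
    coeff_mk]
  rw [Finset.sum_sigma', Finset.sum_sigma']
  refine Finset.sum_nbij' (fun x => ⟨N - x.1 + x.2, x.2⟩) (fun x => ⟨N - x.1 + x.2, x.2⟩)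
    ?_ ?_ ?_ ?_ ?_
  · rintro ⟨a, b⟩ h
    simp only [Finset.mem_sigma, Finset.mem_range] at *
    omega
  · rintro ⟨a, b⟩ h
    simp only [Finset.mem_sigma, Finset.mem_range] at *
    omega
  · rintro ⟨a, b⟩ h
    simp only [Finset.mem_sigma, Finset.mem_range] at *
    rw [show N - (N - a + b) + b = a by omega]
  · rintro ⟨a, b⟩ h
    simp only [Finset.mem_sigma, Finset.mem_range] at *
    rw [show N - (N - a + b) + b = a by omega]
  · rintro ⟨a, b⟩ h
    simp only [Finset.mem_sigma, Finset.mem_range] at *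
    rw [show N - (N - a + b) = a - b by omega, show N - a + b - b = N - a by omega]

theorem zrow_ev (N : ℕ) (c : ℕ → Mq q) (M : Matrix (Fin (N + 1) × Fin q) (Fin q) ℂ) (z : ℂ) :
    zrow q c N * (Rmat q N (starRingEnd ℂ z))ᴴ * M = ev N (gs c * rev N M) z := by
  rw [ev_gs_mul]
  have hR : ∀ (a : Fin q) (k : Fin (N + 1)) (e : Fin q),
      (zrow q c N * (Rmat q N (starRingEnd ℂ z))ᴴ) a (k, e) =
      ∑ l ∈ Finset.range (k.1 + 1), z ^ (k.1 - l) * c l a e := by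
    intro a k e
    rw [Matrix.mul_apply, Fintype.sum_prod_type]
    have hsub : Finset.range (k.1 + 1) ⊆ Finset.range (N + 1) := by
      have := k.2
      intro x hx
      rw [Finset.mem_range] at *
      omega
    have h1 : ∀ l ∈ Finset.range (k.1 + 1), z ^ (k.1 - l) * c l a e =
        if l ≤ k.1 then z ^ (k.1 - l) * c l a e else 0 := by
      intro l hl
      rw [Finset.mem_range] at hl
      rw [if_pos (by omega)]
    rw [Finset.sum_congr rfl h1, Finset.sum_subset hsub, Finset.sum_range]
    · apply Finset.sum_congr rfl
      intro l _
      rw [Rmat_apply, Finset.sum_eq_single e]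
      · simp only [zrow, of_apply, conjTranspose_apply]
        by_cases h : l.1 ≤ k.1
        · rw [if_pos ⟨h, trivial⟩, if_pos h]
          simp [mul_comm]
        · rw [if_neg (fun h2 => h h2.1), if_neg h]
          simp
      · intro b _ hb
        simp only [zrow, of_apply, conjTranspose_apply]
        rw [if_neg (fun h2 => hb h2.2.symm)]
        simp
      · intro h; exact absurd (Finset.mem_univ _) h
    · intro l _ hl
      rw [Finset.mem_range] at hl
      rw [if_neg (by omega)]
  ext a b
  rw [Matrix.mul_apply, Fintype.sum_prod_type, Finset.sum_range, Matrix.sum_apply]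
  apply Finset.sum_congr rfl
  intro k _
  rw [rev_coeff]
  simp only [hR, Matrix.sum_apply, Matrix.smul_apply, Matrix.mul_apply, of_apply, smul_eq_mul,
    Finset.sum_mul, Finset.mul_sum]
  rw [Finset.sum_comm]
  simp only [mul_assoc]

theorem vcol_eq (n : ℕ) : (vcol q n)ᴴ = zrow q (fun j => if j = 0 then 1 else 0) n := by
  ext a ⟨k, b⟩
  simp only [vcol, zrow, of_apply, conjTranspose_apply]
  by_cases hk : k.1 = 0
  · simp only [hk, true_and, if_true, Matrix.one_apply, eq_comm]
    split_ifs <;> simp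
  · simp [hk]

theorem gs_one : gs (fun j => if j = 0 then 1 else 0 : ℕ → Mq q) = 1 := by
  ext n : 1
  simp [gs, coeff_one]

theorem ucol_eq {s : ℕ → Mq q} (hs : ∀ j, (s j)ᴴ = s j) (n : ℕ) :
    (ucol q s n)ᴴ = -zrow q (fun j => if j = 0 then 0 else s (j - 1)) n := by
  ext a ⟨k, b⟩
  simp only [ucol, zrow, of_apply, conjTranspose_apply, Matrix.neg_apply]
  by_cases hk : k.1 = 0
  · simp [hk]
  · simp only [hk, if_false, star_neg, neg_inj]
    exact congrFun (congrFun (hs (k.1 - 1)) a) b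

theorem gs_X (s : ℕ → Mq q) : gs (fun j => if j = 0 then 0 else s (j - 1)) = X * gs s := by
  ext n : 1
  cases n with
  | zero => simp [gs]
  | succ n => rw [coeff_succ_X_mul]; simp [gs]

theorem colK_eq (s : ℕ → Mq q) (n : ℕ) : colK q s n = colH q (sh s) n := by
  ext p b
  simp only [colK, colH, of_apply, Kmat_eq, sh]
  have : ∀ r : ℕ, n + 2 + r = n + 1 + r + 1 := by intro r; omega
  simp only [this]

theorem isOP_zero (s : ℕ → Mq q) : IsOP s 0 1 :=
  ⟨by simp, fun m hm => by rw [coeff_one, if_neg (by omega)], fun j hj => by omega⟩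

theorem isOP_colH {s : ℕ → Mq q} (hs : IsStieltjesPD q s) (n : ℕ) :
    IsOP s (n + 1) (rev (n + 1) (colH q s n)) := by
  refine ⟨?_, ?_, ?_⟩
  · have := rev_coeff (n + 1) (colH q s n) (Fin.last (n + 1))
    rw [show n + 1 - (Fin.last (n + 1)).1 = 0 by simp] at this
    rw [this]
    ext a b
    simp only [colH, of_apply]
    rw [dif_neg (by simp), Matrix.one_apply]
  · exact rev_deg _ _
  · intro j hj
    rw [coeff_hankel s (n + 1) j _ (rev_deg _ _), Finset.sum_range]
    simp only [rev_coeff]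
    rw [Fin.sum_univ_castSucc]
    have hu : IsUnit (Hmat q s n).det := (Matrix.isUnit_iff_isUnit_det _).mp (hs n).1.isUnit
    set Y : Matrix (Fin (n + 1) × Fin q) (Fin q) ℂ :=
      Matrix.of fun (r : Fin (n + 1) × Fin q) (c : Fin q) => s (n + 1 + r.1.1) r.2 c with hY
    have h := Matrix.mul_nonsing_inv_cancel_left (Hmat q s n) Y hu
    ext a b
    have h2 := congrFun (congrFun h (⟨j, hj⟩, a)) b
    rw [Matrix.mul_apply, Fintype.sum_prod_type] at h2
    rw [Matrix.add_apply, Matrix.sum_apply, Matrix.zero_apply]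
    have e1 : ∀ k : Fin (n + 1), (s (j + (Fin.castSucc k).1) *
        Matrix.of fun a b => colH q s n (Fin.castSucc k, a) b) a b =
        -∑ c, Hmat q s n (⟨j, hj⟩, a) (k, c) * ((Hmat q s n)⁻¹ * Y) (k, c) b := by
      intro k
      rw [Matrix.mul_apply, ← Finset.sum_neg_distrib]
      apply Finset.sum_congr rfl
      intro c _
      simp only [colH, of_apply, Fin.val_castSucc]
      rw [dif_pos k.2, Matrix.neg_apply, mul_neg]
      rfl
    have e2 : (s (j + (Fin.last (n + 1)).1) *
        Matrix.of fun a b => colH q s n (Fin.last (n + 1), a) b) a b = Y (⟨j, hj⟩, a) b := by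
      have : (Matrix.of fun a b => colH q s n (Fin.last (n + 1), a) b) = (1 : Mq q) := by
        ext a b
        simp only [colH, of_apply]
        rw [dif_neg (by simp), Matrix.one_apply]
      rw [this, mul_one, hY]
      simp only [of_apply, Fin.val_last]
      rw [add_comm]
    rw [e2, Finset.sum_congr rfl (fun k _ => e1 k), Finset.sum_neg_distrib, h2]
    simp

theorem exists_OP {s : ℕ → Mq q} (hs : IsStieltjesPD q s) (n : ℕ) :
    ∃ p, IsOP s n p ∧ ∀ z, Ppoly q s n z = ev n p z ∧ Qpoly q s n z = ev n (X * (gs s * p)) z := by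
  cases n with
  | zero =>
    refine ⟨1, isOP_zero s, fun z => ⟨?_, ?_⟩⟩
    · rw [ev_zero]; simp [Ppoly]
    · rw [ev_zero]; simp [Qpoly]
  | succ n =>
    refine ⟨_, isOP_colH hs n, fun z => ⟨?_, ?_⟩⟩
    · simp only [Ppoly]
      rw [vcol_eq, zrow_ev, gs_one, one_mul]
    · simp only [Qpoly]
      rw [ucol_eq (herm_of_PD hs), Matrix.neg_mul, Matrix.neg_mul, neg_neg, zrow_ev, gs_X,
        mul_assoc]

theorem exists_OPhat {s : ℕ → Mq q} (hs : IsStieltjesPD q s) (n : ℕ) :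
    ∃ p, IsOP (sh s) n p ∧ ∀ z, Phat q s n z = ev n p z ∧ Qhat q s n z = ev n (gs s * p) z := by
  cases n with
  | zero =>
    refine ⟨1, isOP_zero _, fun z => ⟨?_, ?_⟩⟩
    · rw [ev_zero]; simp [Phat]
    · rw [ev_zero]; simp [Qhat, gs]
  | succ n =>
    refine ⟨_, isOP_colH (sh_PD hs) n, fun z => ⟨?_, ?_⟩⟩
    · simp only [Phat]
      rw [vcol_eq, zrow_ev, gs_one, one_mul, colK_eq]
    · simp only [Qhat]
      rw [zrow_ev, colK_eq]

theorem isOP_unique {s : ℕ → Mq q} (hs : IsStieltjesPD q s) {n : ℕ} {p p' : PowerSeries (Mq q)}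
    (h : IsOP s n p) (h' : IsOP s n p') : p = p' := by
  have hd0 : constantCoeff (p - p') = 0 := by
    rw [← coeff_zero_eq_constantCoeff_apply, map_sub, h.c0, h'.c0, sub_self]
  obtain ⟨d, hd⟩ := X_dvd_iff.mpr hd0
  have hdc : ∀ k, coeff k d = coeff (k + 1) p - coeff (k + 1) p' := by
    intro k
    rw [← map_sub, hd, coeff_succ_X_mul]
  suffices hz : d = 0 by
    rw [hz, mul_zero] at hd
    exact sub_eq_zero.mp hd
  cases n with
  | zero =>
    ext k : 1
    rw [hdc, h.deg _ (by omega), h'.deg _ (by omega), sub_self, map_zero]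
  | succ n =>
    have hdeg : ∀ k, n < k → coeff k d = 0 := by
      intro k hk
      rw [hdc, h.deg _ (by omega), h'.deg _ (by omega), sub_self]
    have horth : ∀ j, j < n + 1 → coeff (n + 0 + j) (gs s * d) = 0 := by
      intro j hj
      have e : X * (gs s * d) = gs s * p - gs s * p' := by
        rw [← mul_sub, hd, ← mul_assoc, ← mul_assoc, X_mul]
      rw [← coeff_succ_X_mul, e, map_sub, show n + 0 + j + 1 = n + 1 + j by omega, h.orth j hj,
        h'.orth j hj, sub_self]
    by_contra hne
    have hne2 : ∃ k, coeff k d ≠ 0 := by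
      by_contra hc
      push Not at hc
      exact hne ((forall_coeff_eq_zero d).mp hc)
    obtain ⟨k, hk⟩ := hne2
    have : ∃ a i, coeff k d a i ≠ 0 := by
      by_contra hc
      push Not at hc
      exact hk (Matrix.ext hc)
    obtain ⟨a, i, hai⟩ := this
    have hpos := posDef_form (hs n).1 d hdeg i ⟨k, a, hai⟩
    have h0 : form s n 0 d = 0 := by
      unfold form
      apply Finset.sum_eq_zero
      intro j hj
      rw [horth j (Finset.mem_range.mp hj), mul_zero]
    rw [h0] at hpos
    exact lt_irrefl _ hpos

theorem isUnit_ev {s : ℕ → Mq q} (hs : IsStieltjesPD q s) {n : ℕ} {p : PowerSeries (Mq q)}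
    (h : IsOP s n p) {z : ℂ} (hz : ∀ x : ℝ, 0 ≤ x → (x : ℂ) ≠ z) : IsUnit (ev n p z) := by
  cases n with
  | zero => rw [ev_zero, h.c0]; exact isUnit_one
  | succ n =>
    by_contra hu
    rw [Matrix.isUnit_iff_isUnit_det, isUnit_iff_ne_zero, not_not] at hu
    obtain ⟨v, hv, hv0⟩ := Matrix.exists_mulVec_eq_zero_iff.mpr hu
    obtain ⟨i, hi⟩ := Function.ne_iff.mp hv
    let B : Mq q := Matrix.of fun a _ => v a
    have hB : ev (n + 1) p z * B = 0 := by
      ext a b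
      exact congrFun hv0 a
    let g : PowerSeries (Mq q) := PowerSeries.mk fun m => ev m p z * B
    have hdeg' : ∀ k, ev (n + 1 + k) p z * B = 0 := by
      intro k
      induction k with
      | zero => exact hB
      | succ k ih =>
        rw [← add_assoc, ev_succ, h.deg _ (by omega), add_zero, Matrix.smul_mul, ih, smul_zero]
    have hdeg : ∀ k, n < k → coeff k g = 0 := by
      intro k hk
      obtain ⟨l, rfl⟩ := Nat.exists_eq_add_of_le (show n + 1 ≤ k by omega)
      simp only [g, coeff_mk]
      exact hdeg' l
    have hrec : g = p * C B + X * (z • g) := by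
      ext k : 1
      cases k with
      | zero => simp [g, ev_zero]
      | succ k =>
        rw [map_add, coeff_succ_X_mul, coeff_mul_C]
        simp only [g, coeff_mk]
        rw [ev_succ, add_mul, Matrix.smul_mul, add_comm, PowerSeries.coeff_smul, coeff_mk]
    have hsg : gs s * g = gs s * p * C B + X * (z • (gs s * g)) := by
      conv_lhs => rw [hrec]
      rw [mul_add, mul_assoc, ← mul_assoc (gs s) X, ← X_mul, mul_assoc X, mul_smul_comm]
    have hkey : form s n 1 g = z • form s n 0 g := by
      unfold form
      rw [Finset.smul_sum]
      apply Finset.sum_congr rfl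
      intro j hj
      rw [hsg, show n + 1 + j = n + 0 + j + 1 by omega, map_add, coeff_succ_X_mul, coeff_mul_C,
        show n + 0 + j + 1 = n + 1 + j by omega, h.orth j (Finset.mem_range.mp hj), zero_mul,
        zero_add, ← hsg, PowerSeries.coeff_smul, mul_smul_comm]
    have hne : ∃ k a, coeff k g a i ≠ 0 := by
      refine ⟨0, i, ?_⟩
      simp only [g, coeff_mk, ev_zero, h.c0, one_mul]
      exact hi
    have h0 := posDef_form (hs n).1 g hdeg i hne
    have h1 := PD_form1 hs n g hdeg i hne
    rw [hkey, Matrix.smul_apply, smul_eq_mul] at h1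
    set w := form s n 0 g i i
    rw [Complex.lt_def] at h0 h1
    simp only [Complex.zero_re, Complex.zero_im] at h0 h1
    have hw : w = (w.re : ℂ) := by
      apply Complex.ext <;> simp [← h0.2]
    rw [hw] at h1
    simp only [Complex.mul_re, Complex.mul_im, Complex.ofReal_re, Complex.ofReal_im, mul_zero,
      sub_zero, zero_add] at h1
    have him : z.im = 0 := by
      rcases mul_eq_zero.mp h1.2.symm with h | h
      · exact h
      · exact absurd h h0.1.ne'
    have hre : 0 < z.re := by
      by_contra hc
      push Not at hc
      nlinarith [h1.1, h0.1]
    exact hz z.re hre.le (Complex.ext (by simp) (by simp [him]))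

theorem recip_mul {s : ℕ → Mq q} (h0 : IsUnit (s 0)) : gs s * gs (reciprocal q s) = 1 := by
  have hd := (Matrix.isUnit_iff_isUnit_det _).mp h0
  ext n : 1
  rw [coeff_mul, ← Finset.Nat.sum_antidiagonal_swap,
    Finset.Nat.sum_antidiagonal_eq_sum_range_succ_mk]
  simp only [Prod.swap, gs, coeff_mk]
  cases n with
  | zero =>
    simp [reciprocal, Matrix.mul_nonsing_inv _ hd]
  | succ n =>
    rw [Finset.sum_range_succ, Nat.sub_self, reciprocal, ← mul_assoc, mul_neg,
      Matrix.mul_nonsing_inv _ hd, neg_mul, one_mul, coeff_one, if_neg (by omega),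
      Finset.sum_attach (Finset.range (n + 1)) (fun l => s (n + 1 - l) * reciprocal q s l),
      add_neg_cancel]

theorem coeff_st (f : PowerSeries (Mq q)) (n : ℕ) : coeff n (st f) = (coeff n f)ᴴ := by
  simp [st]

theorem st_mul (f g : PowerSeries (Mq q)) : st (f * g) = st g * st f := by
  ext n : 1
  rw [coeff_st, coeff_mul, coeff_mul, ← Finset.Nat.sum_antidiagonal_swap,
    Matrix.conjTranspose_sum]
  simp only [coeff_st, Matrix.conjTranspose_mul, Prod.swap]

theorem st_add (f g : PowerSeries (Mq q)) : st (f + g) = st f + st g := by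
  ext n : 1
  simp [coeff_st]

theorem st_C (a : Mq q) : st (C a) = C aᴴ := by
  ext n : 1
  rw [coeff_st, coeff_C, coeff_C]
  split_ifs <;> simp

theorem st_one : st (1 : PowerSeries (Mq q)) = 1 := by
  rw [← map_one C, st_C]; simp

theorem st_X_pow (k : ℕ) : st (X ^ k : PowerSeries (Mq q)) = X ^ k := by
  ext n : 1
  rw [coeff_st, coeff_X_pow]
  split_ifs <;> simp

theorem st_gs {s : ℕ → Mq q} (hs : ∀ j, (s j)ᴴ = s j) : st (gs s) = gs s := by
  ext n : 1
  simp [coeff_st, gs, hs]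

/-- The basic data of the Katetov transform. -/
structure Kat (s t : ℕ → Mq q) (S' : PowerSeries (Mq q)) : Prop where
  l : S' * gs s = 1
  r : gs s * S' = 1
  herm : ∀ j, (s j)ᴴ = s j
  unit : IsUnit (s 0)
  eq : X * gs t = C (s 0) - C (s 0) * S' * C (s 0)

theorem isUnit_s0 {s : ℕ → Mq q} (hs : IsStieltjesPD q s) : IsUnit (s 0) := by
  have h := (hs 0).1.submatrix (e := fun a : Fin q => ((0 : Fin 1), a)) (by
    intro a b h; exact congrArg (fun p => p.2) h)
  exact h.isUnit

theorem kat_of_PD {s : ℕ → Mq q} (hs : IsStieltjesPD q s) :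
    Kat s (katetov q 1 s) (gs (reciprocal q s)) := by
  have hu := isUnit_s0 hs
  have hd := (Matrix.isUnit_iff_isUnit_det _).mp hu
  have hh := herm_of_PD hs
  have hr := recip_mul hu
  refine ⟨?_, hr, hh, hu, ?_⟩
  · -- a right inverse of a hermitian series is two-sided
    have h2 : st (gs (reciprocal q s)) * gs s = 1 := by
      rw [← st_gs hh, ← st_mul, hr, st_one]
    have h3 : st (gs (reciprocal q s)) = gs (reciprocal q s) := by
      calc st (gs (reciprocal q s)) = st (gs (reciprocal q s)) * (gs s * gs (reciprocal q s)) := by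
            rw [hr, mul_one]
        _ = gs (reciprocal q s) := by rw [← mul_assoc, h2, one_mul]
    rw [h3] at h2
    exact h2
  · ext n : 1
    cases n with
    | zero =>
      rw [map_sub, coeff_mul_C, coeff_C_mul, coeff_zero_X_mul, coeff_zero_C]
      simp only [gs, coeff_mk]
      rw [reciprocal, Matrix.mul_nonsing_inv _ hd, one_mul, sub_self]
    | succ n =>
      rw [map_sub, coeff_mul_C, coeff_C_mul, coeff_succ_X_mul, coeff_succ_C]
      simp only [gs, coeff_mk, katetov, Function.iterate_one, katetov1]
      simp

theorem kat_herm {s t : ℕ → Mq q} {S' : PowerSeries (Mq q)} (h : Kat s t S') (j : ℕ) :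
    (t j)ᴴ = t j := by
  have h2 : st S' * gs s = 1 := by
    rw [← st_gs h.herm, ← st_mul, h.r, st_one]
  have h3 : st S' = S' := by
    calc st S' = st S' * (gs s * S') := by rw [h.r, mul_one]
      _ = S' := by rw [← mul_assoc, h2, one_mul]
  have e := congrArg (coeff (j + 1)) h.eq
  rw [map_sub, coeff_mul_C, coeff_C_mul, coeff_succ_X_mul, coeff_succ_C, zero_sub] at e
  have e3 : (coeff (j + 1) S')ᴴ = coeff (j + 1) S' := by rw [← coeff_st, h3]
  simp only [gs, coeff_mk] at e
  rw [e, Matrix.conjTranspose_neg, Matrix.conjTranspose_mul, Matrix.conjTranspose_mul, h.herm, e3,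
    mul_assoc]

/-- The transfer identity. -/
theorem kat_key {s t : ℕ → Mq q} {S' : PowerSeries (Mq q)} (h : Kat s t S') (M : ℕ)
    (p r e : PowerSeries (Mq q)) (hp : gs s * p = C (s 0) * r + X ^ M * e) :
    X * (gs t * r) = C (s 0) * r - C (s 0) * p + X ^ M * (C (s 0) * S' * e) := by
  have h1 : p = S' * (C (s 0) * r) + X ^ M * (S' * e) := by
    calc p = S' * (gs s * p) := by rw [← mul_assoc, h.l, one_mul]
      _ = _ := by
        rw [hp, mul_add, ← mul_assoc S' (X ^ M) e, ← X_pow_mul, mul_assoc (X ^ M)]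
  have h2 : C (s 0) * (X ^ M * (S' * e)) = X ^ M * (C (s 0) * S' * e) := by
    rw [← mul_assoc, ← X_pow_mul, mul_assoc, mul_assoc (C (s 0))]
  rw [← mul_assoc, h.eq, h1, mul_add, h2]
  noncomm_ring

theorem kat_form {s t : ℕ → Mq q} {S' : PowerSeries (Mq q)} (h : Kat s t S') (m d : ℕ)
    (r : PowerSeries (Mq q)) (hr : ∀ k, m < k → coeff k r = 0) (i : Fin q)
    (hne : ∃ k a, coeff k r a i ≠ 0) :
    ∃ p : PowerSeries (Mq q), (∀ k, m + d < k → coeff k p = 0) ∧ (∃ k a, coeff k p a i ≠ 0) ∧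
      (∀ k, m < k → k ≤ m + d → coeff k (gs s * p) = 0) ∧
      form t m d r = ∑ j ∈ Finset.range (m + 1),
        (coeff (m - j) p)ᴴ * coeff (m + d + 1 + j) (gs s * p) := by
  set N := m + d with hN
  let F := S' * (C (s 0) * r)
  let p : PowerSeries (Mq q) := PowerSeries.mk fun k => if k ≤ N then coeff k F else 0
  let w : PowerSeries (Mq q) := PowerSeries.mk fun k => coeff (N + 1 + k) F
  have hF : F = p + X ^ (N + 1) * w := by
    ext k : 1
    rw [map_add, coeff_X_pow_mul']
    simp only [p, w, coeff_mk]
    by_cases hk : k ≤ N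
    · rw [if_pos hk, if_neg (by omega), add_zero]
    · rw [if_neg hk, if_pos (by omega), zero_add, show N + 1 + (k - (N + 1)) = k by omega]
  have hsF : C (s 0) * r = gs s * p + X ^ (N + 1) * (gs s * w) := by
    calc C (s 0) * r = gs s * F := by simp only [F]; rw [← mul_assoc, h.r, one_mul]
      _ = _ := by rw [hF, mul_add, ← mul_assoc (gs s) (X ^ (N + 1)), ← X_pow_mul, mul_assoc (X ^ (N + 1))]
  have hsp : gs s * p = C (s 0) * r + X ^ (N + 1) * (-(gs s * w)) := by
    rw [hsF, mul_neg]; abel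
  have hlow : ∀ k, k ≤ N → coeff k (gs s * p) = s 0 * coeff k r := by
    intro k hk
    rw [hsp, map_add, coeff_X_pow_mul', if_neg (by omega), add_zero, coeff_C_mul]
  have hhigh : ∀ j, coeff (N + 1 + j) (gs s * p) = coeff j (-(gs s * w)) := by
    intro j
    rw [hsp, map_add, coeff_X_pow_mul', if_pos (by omega), coeff_C_mul, hr _ (by omega), mul_zero,
      zero_add, Nat.add_sub_cancel_left]
  have hp : ∀ k, N < k → coeff k p = 0 := by
    intro k hk
    simp only [p, coeff_mk]
    rw [if_neg (by omega)]
  refine ⟨p, hp, ?_, ?_, ?_⟩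
  · by_contra hc
    push Not at hc
    obtain ⟨k, a, hk⟩ := hne
    have hkN : k ≤ N := by
      by_contra hcc
      rw [hr k (by omega)] at hk
      exact hk rfl
    have hd := (Matrix.isUnit_iff_isUnit_det _).mp h.unit
    have hcol : ∀ b, coeff k (gs s * p) b i = 0 := by
      intro b
      rw [coeff_mul, Matrix.sum_apply]
      apply Finset.sum_eq_zero
      intro x _
      rw [Matrix.mul_apply]
      apply Finset.sum_eq_zero
      intro c _
      rw [hc, mul_zero]
    apply hk
    have : coeff k r = (s 0)⁻¹ * coeff k (gs s * p) := by
      rw [hlow k hkN, Matrix.nonsing_inv_mul_cancel_left _ _ hd]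
    rw [this, Matrix.mul_apply]
    apply Finset.sum_eq_zero
    intro c _
    rw [hcol, mul_zero]
  · intro k hk hkN
    rw [hlow k hkN, hr k hk, mul_zero]
  · have hkey := kat_key h (N + 1) p r _ hsp
    have hw : C (s 0) * S' * (-(gs s * w)) = -(C (s 0) * w) := by
      rw [mul_neg, mul_assoc, ← mul_assoc S', h.l, one_mul]
    rw [hw] at hkey
    have hT : ∀ j, coeff (N + j) (gs t * r) = coeff j (-(C (s 0) * w)) := by
      intro j
      rw [← coeff_succ_X_mul, hkey, map_add, map_sub, coeff_C_mul, coeff_C_mul, hr _ (by omega),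
        hp _ (by omega), mul_zero, sub_zero, zero_add, coeff_X_pow_mul', if_pos (by omega),
        show N + j + 1 - (N + 1) = j by omega]
    have hconv : ∀ f g : PowerSeries (Mq q), ∑ j ∈ Finset.range (m + 1),
        (coeff (m - j) f)ᴴ * coeff j g = coeff m (st f * g) := by
      intro f g
      rw [coeff_mul, ← Finset.Nat.sum_antidiagonal_swap,
        Finset.Nat.sum_antidiagonal_eq_sum_range_succ_mk]
      simp only [Prod.swap, coeff_st]
    unfold form
    simp only [← hN, hT, hhigh]
    rw [hconv, hconv]
    have e1 : st r * C (s 0) = st p * gs s + X ^ (N + 1) * (st w * gs s) := by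
      have := congrArg st hsF
      rw [st_mul, st_add, st_mul, st_mul, st_mul, st_C, st_X_pow, st_gs h.herm, h.herm] at this
      rw [this, X_pow_mul]
    have e2 : st r * (-(C (s 0) * w)) =
        st p * (-(gs s * w)) + X ^ (N + 1) * (-(st w * gs s * w)) := by
      rw [mul_neg, ← mul_assoc, e1]
      noncomm_ring
    rw [e2, map_add, coeff_X_pow_mul', if_neg (by omega), add_zero]

theorem kat_PD {s t : ℕ → Mq q} {S' : PowerSeries (Mq q)} (hs : IsStieltjesPD q s)
    (h : Kat s t S') : IsStieltjesPD q t := by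
  intro m
  constructor
  · apply form_posDef (kat_herm h)
    intro r i hr hne
    obtain ⟨p, hp, hpne, -, hf⟩ := kat_form h m 0 r hr i hne
    rw [hf]
    exact PD_form1 hs m p hp i hpne
  · rw [Kmat_eq]
    apply form_posDef (s := sh t) (fun j => kat_herm h (j + 1))
    intro r i hr hne
    obtain ⟨p, hp, hpne, h0, hf⟩ := kat_form h m 1 r hr i hne
    rw [form_sh t m 0 r hr, zero_add, hf]
    have := posDef_form (hs (m + 1)).1 p hp i hpne
    unfold form at this
    rw [Finset.sum_range_succ', add_zero, h0 (m + 1) (by omega) le_rfl, mul_zero,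
      add_zero] at this
    have e : ∀ j, (coeff (m + 1 - (j + 1)) p)ᴴ * coeff (m + 1 + (j + 1)) (gs s * p) =
        (coeff (m - j) p)ᴴ * coeff (m + 1 + 1 + j) (gs s * p) := by
      intro j
      rw [show m + 1 - (j + 1) = m - j by omega, show m + 1 + (j + 1) = m + 1 + 1 + j by omega]
    simp only [e] at this
    exact this

/-- Transfer to the transformed sequence, `Q_n` and `P̂_{n-1}`. -/
theorem transfer {s t : ℕ → Mq q} {S' : PowerSeries (Mq q)} (h : Kat s t S') (L M : ℕ)
    (hLM : L < M) (p : PowerSeries (Mq q)) (hc : coeff 0 p = 1)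
    (hor : ∀ k, L < k → k < M → coeff k (gs s * p) = 0) :
    ∃ r e : PowerSeries (Mq q), coeff 0 r = 1 ∧ (∀ k, L < k → coeff k r = 0) ∧
      (∀ k, k ≤ L → s 0 * coeff k r = coeff k (gs s * p)) ∧
      X * (gs t * r) = C (s 0) * r - C (s 0) * p + X ^ M * e := by
  have hd := (Matrix.isUnit_iff_isUnit_det _).mp h.unit
  let r : PowerSeries (Mq q) :=
    PowerSeries.mk fun k => if k ≤ L then (s 0)⁻¹ * coeff k (gs s * p) else 0
  have hlow : ∀ k, k ≤ L → s 0 * coeff k r = coeff k (gs s * p) := by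
    intro k hk
    simp only [r, coeff_mk]
    rw [if_pos hk, Matrix.mul_nonsing_inv_cancel_left _ _ hd]
  have hdeg : ∀ k, L < k → coeff k r = 0 := by
    intro k hk
    simp only [r, coeff_mk]
    rw [if_neg (by omega)]
  have hdvd : (X : PowerSeries (Mq q)) ^ M ∣ gs s * p - C (s 0) * r := by
    rw [X_pow_dvd_iff]
    intro k hk
    rw [map_sub, coeff_C_mul]
    by_cases hkL : k ≤ L
    · rw [hlow k hkL, sub_self]
    · rw [hdeg k (by omega), hor k (by omega) hk, mul_zero, sub_self]
  obtain ⟨e, he⟩ := hdvd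
  refine ⟨r, _, ?_, hdeg, hlow, kat_key h M p r e (by rw [← he]; abel)⟩
  simp only [r, coeff_mk]
  rw [if_pos (by omega), coeff_mul]
  simp only [Finset.Nat.antidiagonal_zero, Finset.sum_singleton, hc, mul_one, gs, coeff_mk]
  exact Matrix.nonsing_inv_mul _ hd

theorem main1 {s t : ℕ → Mq q} {S' : PowerSeries (Mq q)} (hs : IsStieltjesPD q s)
    (h : Kat s t S') (n : ℕ) (z : ℂ) :
    Qpoly q s (n + 1) z = s 0 * Phat q t n z ∧
      Qhat q t n z = z • Qpoly q s (n + 1) z - s 0 * Ppoly q s (n + 1) z := by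
  have ht := kat_PD hs h
  obtain ⟨p, hp, hpz⟩ := exists_OP hs (n + 1)
  obtain ⟨p', hp', hpz'⟩ := exists_OPhat ht n
  obtain ⟨r, e, hr0, hrd, hrl, hre⟩ := transfer h n (2 * n + 2) (by omega) p hp.c0 (by
    intro k h1 h2
    obtain ⟨j, rfl⟩ := Nat.exists_eq_add_of_le (show n + 1 ≤ k by omega)
    exact hp.orth j (by omega))
  have hr : IsOP (sh t) n r := by
    refine ⟨hr0, hrd, ?_⟩
    intro j hj
    rw [← coeff_sh t _ _ (hrd _ (by omega)), ← coeff_succ_X_mul, hre, map_add, map_sub,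
      coeff_C_mul, coeff_C_mul, hrd _ (by omega), hp.deg _ (by omega), coeff_X_pow_mul',
      if_neg (by omega)]
    simp
  have hrp := isOP_unique (sh_PD ht) hp' hr
  subst hrp
  have hQ : Qpoly q s (n + 1) z = s 0 * Phat q t n z := by
    rw [(hpz z).2, (hpz' z).1, ev_X_mul, ← ev_C_mul]
    apply ev_congr
    intro k hk
    rw [coeff_C_mul, hrl k hk]
  refine ⟨hQ, ?_⟩
  rw [hQ, (hpz' z).2, (hpz z).1, (hpz' z).1, ← ev_X_mul, hre, ev_add, ev_sub, ev_C_mul, ev_C_mul,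
    ev_succ n p', hrd _ (by omega), add_zero, mul_smul_comm]
  have : ev (n + 1) (X ^ (2 * n + 2) * e) z = ev (n + 1) (C 0 * e) z := by
    apply ev_congr
    intro k hk
    rw [coeff_X_pow_mul', if_neg (by omega)]
    simp
  rw [this, ev_C_mul, zero_mul, add_zero]

theorem main2 {s t : ℕ → Mq q} {S' : PowerSeries (Mq q)} (hs : IsStieltjesPD q s)
    (h : Kat s t S') (n : ℕ) (z : ℂ) :
    Qhat q s n z = s 0 * Ppoly q t n z ∧
      Qpoly q t n z = Qhat q s n z - s 0 * Phat q s n z := by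
  have ht := kat_PD hs h
  obtain ⟨p, hp, hpz⟩ := exists_OPhat hs n
  obtain ⟨p', hp', hpz'⟩ := exists_OP ht n
  obtain ⟨r, e, hr0, hrd, hrl, hre⟩ := transfer h n (2 * n + 1) (by omega) p hp.c0 (by
    intro k h1 h2
    obtain ⟨j, rfl⟩ := Nat.exists_eq_add_of_le (show n + 1 ≤ k by omega)
    rw [show n + 1 + j = n + j + 1 by omega, coeff_sh _ _ _ (hp.deg _ (by omega))]
    exact hp.orth j (by omega))
  have hr : IsOP t n r := by
    refine ⟨hr0, hrd, ?_⟩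
    intro j hj
    rw [← coeff_succ_X_mul, hre, map_add, map_sub,
      coeff_C_mul, coeff_C_mul, hrd _ (by omega), hp.deg _ (by omega), coeff_X_pow_mul',
      if_neg (by omega)]
    simp
  have hrp := isOP_unique ht hp' hr
  subst hrp
  have hQ : Qhat q s n z = s 0 * Ppoly q t n z := by
    rw [(hpz z).2, (hpz' z).1, ← ev_C_mul]
    apply ev_congr
    intro k hk
    rw [coeff_C_mul, hrl k hk]
  refine ⟨hQ, ?_⟩
  rw [hQ, (hpz' z).2, (hpz z).1, (hpz' z).1, hre, ev_add, ev_sub, ev_C_mul, ev_C_mul]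
  have : ev n (X ^ (2 * n + 1) * e) z = ev n (C 0 * e) z := by
    apply ev_congr
    intro k hk
    rw [coeff_X_pow_mul', if_neg (by omega)]
    simp
  rw [this, ev_C_mul, zero_mul, add_zero]

end Pade

/-- Hurwitz-type identities relating the polynomials of the original sequence and those of its
first Kátětov transform, for `z` outside `[0,∞)`. -/
theorem stmt19 (q : ℕ) (hq : 1 ≤ q) (s : ℕ → Mq q) (hs : IsStieltjesPD q s) (n : ℕ) (hn : 1 ≤ n) (z : ℂ)
    (hz : ∀ x : ℝ, 0 ≤ x → (x : ℂ) ≠ z) :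
    IsUnit (Qpoly q s n z) ∧ IsUnit (Qhat q s n z) ∧
      IsUnit (Ppoly q (katetov q 1 s) n z) ∧ IsUnit (Phat q (katetov q 1 s) (n - 1) z) ∧
      s 0 * (Ppoly q s n z * (Qpoly q s n z)⁻¹) * s 0 +
          Qhat q (katetov q 1 s) (n - 1) z * (Phat q (katetov q 1 s) (n - 1) z)⁻¹ =
        z • s 0 ∧
      s 0 * (Phat q s n z * (Qhat q s n z)⁻¹) * s 0 +
          Qpoly q (katetov q 1 s) n z * (Ppoly q (katetov q 1 s) n z)⁻¹ =
        s 0 := by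
  obtain ⟨n, rfl⟩ : ∃ k, n = k + 1 := ⟨n - 1, by omega⟩
  rw [Nat.add_sub_cancel]
  have hk := Pade.kat_of_PD hs
  have ht := Pade.kat_PD hs hk
  set t := katetov q 1 s with htdef
  obtain ⟨a1, a2⟩ := Pade.main1 hs hk n z
  obtain ⟨b1, b2⟩ := Pade.main2 hs hk (n + 1) z
  have h0 := hk.unit
  have hd0 := (Matrix.isUnit_iff_isUnit_det _).mp h0
  have hP : IsUnit (Ppoly q t (n + 1) z) := by
    obtain ⟨p, hp, hpz⟩ := Pade.exists_OP ht (n + 1)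
    rw [(hpz z).1]
    exact Pade.isUnit_ev ht hp hz
  have hPh : IsUnit (Phat q t n z) := by
    obtain ⟨p, hp, hpz⟩ := Pade.exists_OPhat ht n
    rw [(hpz z).1]
    exact Pade.isUnit_ev (Pade.sh_PD ht) hp hz
  have hQ : IsUnit (Qpoly q s (n + 1) z) := by rw [a1]; exact h0.mul hPh
  have hQh : IsUnit (Qhat q s (n + 1) z) := by rw [b1]; exact h0.mul hP
  have hdP := (Matrix.isUnit_iff_isUnit_det _).mp hP
  have hdPh := (Matrix.isUnit_iff_isUnit_det _).mp hPh
  refine ⟨hQ, hQh, hP, hPh, ?_, ?_⟩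
  · have e : (Qpoly q s (n + 1) z)⁻¹ * s 0 = (Phat q t n z)⁻¹ := by
      rw [a1, Matrix.mul_inv_rev, Matrix.mul_assoc, Matrix.nonsing_inv_mul _ hd0, Matrix.mul_one]
    rw [Matrix.mul_assoc, Matrix.mul_assoc, e, a2, sub_mul, ← Matrix.mul_assoc (s 0),
      add_sub_cancel, a1, Matrix.smul_mul, Matrix.mul_nonsing_inv_cancel_right _ _ hdPh]
  · have e : (Qhat q s (n + 1) z)⁻¹ * s 0 = (Ppoly q t (n + 1) z)⁻¹ := by
      rw [b1, Matrix.mul_inv_rev, Matrix.mul_assoc, Matrix.nonsing_inv_mul _ hd0, Matrix.mul_one]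
    rw [Matrix.mul_assoc, Matrix.mul_assoc, e, b2, sub_mul, ← Matrix.mul_assoc (s 0),
      add_sub_cancel, b1, Matrix.mul_nonsing_inv_cancel_right _ _ hdP]

end
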